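/- arXiv:2408.09685 — 8 statements merged into one kernel-verified Lean document; each statement's English description precedes it below -/
import Mathlib

section
/- Let A₀ ⊊ A ⊆ F₂^{n₁} and B₀ ⊊ B ⊆ F₂^{n₂} be binary linear codes. Then wt((A₀ ⊕ B₀)^⊥ \ (A ⊕ B)^⊥) = min{ wt(A₀^⊥ \ A^⊥), wt(B₀^⊥ \ B^⊥) }. (This identity gives the distance min{d_a, d_b} of the triorthogonal code obtained from the block-diagonal direct sum of two triorthogonal matrices with distances d_a and d_b.) -/
/-- The Hamming weight of a binary vector: the number of nonzero coordinates. -/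
def wt {n : ℕ} (x : Fin n → ZMod 2) : ℕ := (Finset.univ.filter fun j => x j ≠ 0).card

/-- The minimum Hamming weight of the nonzero elements of a set of binary vectors. -/
noncomputable def wtSet {n : ℕ} (S : Set (Fin n → ZMod 2)) : ℕ :=
  sInf (wt '' {x ∈ S | x ≠ 0})

/-- The dual of a set of vectors in `F₂ⁿ`: all vectors with even overlap with every element. -/
def dualSet {n : ℕ} (S : Set (Fin n → ZMod 2)) : Set (Fin n → ZMod 2) :=
  {x | ∀ c ∈ S, ∑ j, x j * c j = 0}

/-- The direct sum (by concatenation) of two sets of binary vectors. -/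
def dsum {n₁ n₂ : ℕ} (S₁ : Set (Fin n₁ → ZMod 2)) (S₂ : Set (Fin n₂ → ZMod 2)) :
    Set (Fin (n₁ + n₂) → ZMod 2) :=
  {w | ∃ u ∈ S₁, ∃ v ∈ S₂, w = Fin.append u v}

theorem wt_append {n₁ n₂ : ℕ} (u : Fin n₁ → ZMod 2) (v : Fin n₂ → ZMod 2) :
    wt (Fin.append u v) = wt u + wt v := by
  simp only [wt, Finset.card_filter, Fin.sum_univ_add, Fin.append_left, Fin.append_right]

theorem wt_zero_vec {n : ℕ} : wt (0 : Fin n → ZMod 2) = 0 := by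
  simp [wt]

theorem zero_mem_dualSet {n : ℕ} (S : Set (Fin n → ZMod 2)) : 0 ∈ dualSet S := by
  intro c _
  simp

theorem append_mem_dualSet {n₁ n₂ : ℕ} (A : Submodule (ZMod 2) (Fin n₁ → ZMod 2))
    (B : Submodule (ZMod 2) (Fin n₂ → ZMod 2)) (x : Fin n₁ → ZMod 2) (y : Fin n₂ → ZMod 2) :
    Fin.append x y ∈ dualSet (dsum (A : Set (Fin n₁ → ZMod 2)) (B : Set (Fin n₂ → ZMod 2))) ↔
      x ∈ dualSet (A : Set (Fin n₁ → ZMod 2)) ∧ y ∈ dualSet (B : Set (Fin n₂ → ZMod 2)) := by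
  constructor
  · intro h
    constructor
    · intro c hc
      have := h _ ⟨c, hc, 0, B.zero_mem, rfl⟩
      simpa [Fin.sum_univ_add] using this
    · intro c hc
      have := h _ ⟨0, A.zero_mem, c, hc, rfl⟩
      simpa [Fin.sum_univ_add] using this
  · rintro ⟨hx, hy⟩ w ⟨u, hu, v, hv, rfl⟩
    have h1 := hx u hu
    have h2 := hy v hv
    simp [Fin.sum_univ_add, h1, h2]

theorem wtSet_le {n : ℕ} {S T : Set (Fin n → ZMod 2)} {x : Fin n → ZMod 2}
    (hx : x ∈ S \ dualSet T) : wtSet (S \ dualSet T) ≤ wt x := by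
  refine Nat.sInf_le ⟨x, ⟨hx, ?_⟩, rfl⟩
  rintro rfl
  exact hx.2 (zero_mem_dualSet T)

theorem wtSet_attained {n : ℕ} {S T : Set (Fin n → ZMod 2)}
    (h : (S \ dualSet T).Nonempty) :
    ∃ x ∈ S \ dualSet T, wt x = wtSet (S \ dualSet T) := by
  obtain ⟨x, hx⟩ := h
  have hne : (wt '' {x ∈ S \ dualSet T | x ≠ 0}).Nonempty := by
    refine ⟨wt x, x, ⟨hx, ?_⟩, rfl⟩
    rintro rfl
    exact hx.2 (zero_mem_dualSet T)
  obtain ⟨y, hy, hyw⟩ := Nat.sInf_mem hne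
  exact ⟨y, hy.1, hyw⟩

theorem dual_diff_nonempty {n : ℕ} {A₀ A : Submodule (ZMod 2) (Fin n → ZMod 2)} (h : A₀ < A) :
    (dualSet (A₀ : Set (Fin n → ZMod 2)) \ dualSet (A : Set (Fin n → ZMod 2))).Nonempty := by
  obtain ⟨a, ha, ha0⟩ := SetLike.exists_of_lt h
  obtain ⟨f, hf, hk⟩ := Submodule.exists_le_ker_of_notMem ha0
  have key : ∀ c : Fin n → ZMod 2, ∑ j, f (Pi.single j 1) * c j = f c := by
    intro c
    rw [LinearMap.pi_apply_eq_sum_univ f c]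
    refine Finset.sum_congr rfl fun j _ => ?_
    rw [smul_eq_mul, mul_comm]
    congr 2
    ext k
    simp [Pi.single_apply, eq_comm]
  refine ⟨fun j => f (Pi.single j 1), ?_, ?_⟩
  · intro c hc
    exact (key c).trans (hk hc)
  · intro hd
    exact hf ((key a).symm.trans (hd a ha))

/-- for binary linear codes `A₀ ⊊ A ⊆ F₂^{n₁}` and `B₀ ⊊ B ⊆ F₂^{n₂}`,
`wt((A₀ ⊕ B₀)^⊥ \ (A ⊕ B)^⊥) = min{ wt(A₀^⊥ \ A^⊥), wt(B₀^⊥ \ B^⊥) }`. -/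
theorem stmt_8 {n₁ n₂ : ℕ} (A₀ A : Submodule (ZMod 2) (Fin n₁ → ZMod 2))
    (B₀ B : Submodule (ZMod 2) (Fin n₂ → ZMod 2)) (hA : A₀ < A) (hB : B₀ < B) :
    wtSet (dualSet (dsum (A₀ : Set (Fin n₁ → ZMod 2)) (B₀ : Set (Fin n₂ → ZMod 2))) \
        dualSet (dsum (A : Set (Fin n₁ → ZMod 2)) (B : Set (Fin n₂ → ZMod 2)))) =
      min (wtSet (dualSet (A₀ : Set (Fin n₁ → ZMod 2)) \
            dualSet (A : Set (Fin n₁ → ZMod 2))))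
        (wtSet (dualSet (B₀ : Set (Fin n₂ → ZMod 2)) \
            dualSet (B : Set (Fin n₂ → ZMod 2)))) := by
  apply le_antisymm
  · apply le_min
    · obtain ⟨x, hx, hw⟩ := wtSet_attained (dual_diff_nonempty hA)
      rw [← hw, ← Nat.add_zero (wt x), ← wt_zero_vec (n := n₂), ← wt_append]
      refine wtSet_le ⟨(append_mem_dualSet _ _ _ _).2 ⟨hx.1, zero_mem_dualSet _⟩, fun h => ?_⟩
      exact hx.2 ((append_mem_dualSet _ _ _ _).1 h).1
    · obtain ⟨x, hx, hw⟩ := wtSet_attained (dual_diff_nonempty hB)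
      rw [← hw, ← Nat.zero_add (wt x), ← wt_zero_vec (n := n₁), ← wt_append]
      refine wtSet_le ⟨(append_mem_dualSet _ _ _ _).2 ⟨zero_mem_dualSet _, hx.1⟩, fun h => ?_⟩
      exact hx.2 ((append_mem_dualSet _ _ _ _).1 h).2
  · have hne : (dualSet (dsum (A₀ : Set (Fin n₁ → ZMod 2)) (B₀ : Set (Fin n₂ → ZMod 2))) \
        dualSet (dsum (A : Set (Fin n₁ → ZMod 2)) (B : Set (Fin n₂ → ZMod 2)))).Nonempty := by
      obtain ⟨x, hx⟩ := dual_diff_nonempty hA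
      exact ⟨Fin.append x 0, (append_mem_dualSet _ _ _ _).2 ⟨hx.1, zero_mem_dualSet _⟩,
        fun h => hx.2 ((append_mem_dualSet _ _ _ _).1 h).1⟩
    obtain ⟨w, hw, hwt⟩ := wtSet_attained hne
    rw [← hwt]
    obtain ⟨x, y, rfl⟩ : ∃ x y, w = Fin.append (m := n₁) (n := n₂) x y :=
      ⟨_, _, (Fin.append_castAdd_natAdd (f := w)).symm⟩
    obtain ⟨h0, h1⟩ := hw
    rw [append_mem_dualSet] at h0 h1
    rw [wt_append]
    by_cases hx : x ∈ dualSet (A : Set (Fin n₁ → ZMod 2))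
    · have hy : y ∉ dualSet (B : Set (Fin n₂ → ZMod 2)) := fun hy => h1 ⟨hx, hy⟩
      exact (min_le_right _ _).trans ((wtSet_le ⟨h0.2, hy⟩).trans (Nat.le_add_left _ _))
    · exact (min_le_left _ _).trans ((wtSet_le ⟨h0.1, hx⟩).trans (Nat.le_add_right _ _))
end

section
/- Let G₀ be a binary triorthogonal matrix of size m-by-n, and let 2r ≤ m. Choose 2r pairwise distinct rows of G₀, arranged as matrices A and B each of size r-by-n (so the r rows of A and the r rows of B are 2r distinct rows of G₀). Then the matrix A + B (entrywise sum over F₂, whose i-th row is the sum of the i-th row of A and the i-th row of B) is triorthogonal. -/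
/-- A binary matrix over `F₂ = ZMod 2` is *triorthogonal* if every pair of distinct rows has
even overlap and every triple of distinct rows has even triple overlap. -/
def Triorthogonal {m n : ℕ} (G : Matrix (Fin m) (Fin n) (ZMod 2)) : Prop :=
  (∀ a b : Fin m, a < b → ∑ j, G a j * G b j = 0) ∧
  (∀ a b c : Fin m, a < b → b < c → ∑ j, G a j * G b j * G c j = 0)

theorem Triorthogonal.pair {m n : ℕ} {G : Matrix (Fin m) (Fin n) (ZMod 2)}
    (hG : Triorthogonal G) (a b : Fin m) (h : a ≠ b) : ∑ j, G a j * G b j = 0 := by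
  rcases lt_or_gt_of_ne h with h | h
  · exact hG.1 a b h
  · rw [← hG.1 b a h]
    exact Finset.sum_congr rfl fun j _ => by ring

theorem Triorthogonal.triple {m n : ℕ} {G : Matrix (Fin m) (Fin n) (ZMod 2)}
    (hG : Triorthogonal G) (a b c : Fin m) (hab : a ≠ b) (hac : a ≠ c) (hbc : b ≠ c) :
    ∑ j, G a j * G b j * G c j = 0 := by
  rcases lt_or_gt_of_ne hab with h1 | h1 <;> rcases lt_or_gt_of_ne hac with h2 | h2 <;>
    rcases lt_or_gt_of_ne hbc with h3 | h3
  · exact hG.2 a b c h1 h3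
  · rw [← hG.2 a c b h2 h3]
    exact Finset.sum_congr rfl fun j _ => by ring
  · exact absurd (h1.trans h3) h2.asymm
  · rw [← hG.2 c a b h2 h1]
    exact Finset.sum_congr rfl fun j _ => by ring
  · rw [← hG.2 b a c h1 h2]
    exact Finset.sum_congr rfl fun j _ => by ring
  · exact absurd (h1.trans h2) h3.asymm
  · rw [← hG.2 b c a h3 h2]
    exact Finset.sum_congr rfl fun j _ => by ring
  · rw [← hG.2 c b a h3 h1]
    exact Finset.sum_congr rfl fun j _ => by ring

/-- if `A` and `B` each consist of `r` rows of a triorthogonal matrix `G₀`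
(`2r ≤ m`), all `2r` chosen rows being pairwise distinct, then the entrywise sum `A + B` is
triorthogonal.  Here `A` has rows `G₀ (f a)` and `B` has rows `G₀ (g a)`, and the injectivity
of `Sum.elim f g` expresses that the `2r` chosen rows are pairwise distinct rows of `G₀`. -/
theorem stmt_9 {m n r : ℕ} (G₀ : Matrix (Fin m) (Fin n) (ZMod 2)) (hG : Triorthogonal G₀)
    (hr : 2 * r ≤ m) (f g : Fin r → Fin m)
    (hinj : Function.Injective (Sum.elim f g)) :
    Triorthogonal (Matrix.of fun a : Fin r => G₀ (f a) + G₀ (g a)) := by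
  have hff : ∀ a b, a ≠ b → f a ≠ f b := fun a b h e =>
    h (Sum.inl.inj (@hinj (Sum.inl a) (Sum.inl b) e))
  have hgg : ∀ a b, a ≠ b → g a ≠ g b := fun a b h e =>
    h (Sum.inr.inj (@hinj (Sum.inr a) (Sum.inr b) e))
  have hfg : ∀ a b, f a ≠ g b := fun a b e =>
    Sum.inl_ne_inr (@hinj (Sum.inl a) (Sum.inr b) e)
  have hgf : ∀ a b, g a ≠ f b := fun a b e => hfg b a e.symm
  constructor
  · intro a b hab
    have h := hab.ne
    simp only [Matrix.of_apply, Pi.add_apply, add_mul, mul_add, Finset.sum_add_distrib]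
    rw [hG.pair _ _ (hff a b h), hG.pair _ _ (hfg a b), hG.pair _ _ (hgf a b),
      hG.pair _ _ (hgg a b h)]
    simp
  · intro a b c hab hbc
    have h1 := hab.ne
    have h2 := hbc.ne
    have h3 := (hab.trans hbc).ne
    simp only [Matrix.of_apply, Pi.add_apply, add_mul, mul_add, Finset.sum_add_distrib]
    rw [hG.triple _ _ _ (hff a b h1) (hff a c h3) (hff b c h2),
      hG.triple _ _ _ (hff a b h1) (hfg a c) (hfg b c),
      hG.triple _ _ _ (hfg a b) (hff a c h3) (hgf b c),
      hG.triple _ _ _ (hfg a b) (hfg a c) (hgg b c h2),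
      hG.triple _ _ _ (hgf a b) (hgf a c) (hff b c h2),
      hG.triple _ _ _ (hgf a b) (hgg a c h3) (hfg b c),
      hG.triple _ _ _ (hgg a b h1) (hgf a c) (hgf b c),
      hG.triple _ _ _ (hgg a b h1) (hgg a c h3) (hgg b c h2)]
    simp
end

section
/- Let G₀ be a binary triorthogonal matrix of size n-by-m with rows g₁,…,g_n, let x ∈ F₂^m be any vector, and set yᵢ = x ∧ gᵢ (coordinatewise product). Let 𝟏 and 𝟎 denote the all-one and all-zero vectors of length m. Then the (n+1)-by-3m matrix G whose first row is (𝟏 | 𝟎 | x) and whose (i+1)-st row is (yᵢ | yᵢ | gᵢ) for 1 ≤ i ≤ n is triorthogonal. -/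
/-- building-up construction: if `G₀` is an `n × m` triorthogonal matrix with
rows `gᵢ`, `x ∈ F₂^m`, and `yᵢ = x ∧ gᵢ` (coordinatewise product), then the `(n+1) × 3m` matrix
with first row `(𝟏 | 𝟎 | x)` and remaining rows `(yᵢ | yᵢ | gᵢ)` is triorthogonal. -/
theorem stmt_10 {n m : ℕ} (G₀ : Matrix (Fin n) (Fin m) (ZMod 2)) (hG : Triorthogonal G₀)
    (x : Fin m → ZMod 2) :
    Triorthogonal (Matrix.of (Fin.cons
      (Fin.append (Fin.append (1 : Fin m → ZMod 2) (0 : Fin m → ZMod 2)) x)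
      (fun i : Fin n => Fin.append (Fin.append (x * G₀ i) (x * G₀ i)) (G₀ i)))) := by
  have hadd : ∀ a : ZMod 2, a + a = 0 := CharTwo.add_self_eq_zero
  have hsq : ∀ a : ZMod 2, a * a = a := by decide
  obtain ⟨h2, h3⟩ := hG
  constructor
  · intro a b hab
    induction b using Fin.cases with
    | zero => exact absurd hab (Fin.not_lt_zero a)
    | succ b =>
      induction a using Fin.cases with
      | zero =>
        simp [-Fin.natAdd_eq_addNat, Fin.sum_univ_add, hadd]
      | succ a =>
        have := h2 a b (Fin.succ_lt_succ_iff.mp hab)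
        simp [-Fin.natAdd_eq_addNat, Fin.sum_univ_add, hadd, this]
  · intro a b c hab hbc
    induction c using Fin.cases with
    | zero => exact absurd hbc (Fin.not_lt_zero b)
    | succ c =>
      induction b using Fin.cases with
      | zero => exact absurd hab (Fin.not_lt_zero a)
      | succ b =>
        induction a using Fin.cases with
        | zero =>
          have key : ∀ j, x j * G₀ b j * (x j * G₀ c j) = x j * G₀ b j * G₀ c j := by
            intro j
            rw [mul_mul_mul_comm, hsq, mul_assoc]
          simp [-Fin.natAdd_eq_addNat, Fin.sum_univ_add, key, hadd]
        | succ a =>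
          have := h3 a b c (Fin.succ_lt_succ_iff.mp hab) (Fin.succ_lt_succ_iff.mp hbc)
          simp [-Fin.natAdd_eq_addNat, Fin.sum_univ_add, hadd, this]
end

section
/- Let C ⊆ F₂ⁿ be a binary self-dual code and let G be a generator matrix of C (a matrix whose rows form a basis of C). Then G is a triorthogonal matrix if and only if x ∧ y ∈ C for all x, y ∈ C, where x ∧ y is the coordinatewise product. -/
/-- let `C` be a binary self-dual code with generator matrix `G` (the rows of `G`
form a basis of `C`).  Then `G` is triorthogonal iff `x ∧ y ∈ C` for all `x, y ∈ C`, where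
`x * y` is the coordinatewise product `x ∧ y`. -/
theorem stmt_11 {n k : ℕ} (C : Submodule (ZMod 2) (Fin n → ZMod 2))
    (hsd : (C : Set (Fin n → ZMod 2)) = dualSet (C : Set (Fin n → ZMod 2)))
    (G : Matrix (Fin k) (Fin n) (ZMod 2))
    (hli : LinearIndependent (ZMod 2) fun a : Fin k => G a)
    (hspan : Submodule.span (ZMod 2) (Set.range fun a : Fin k => G a) = C) :
    Triorthogonal G ↔ ∀ x ∈ C, ∀ y ∈ C, x * y ∈ C := by
  have hmem : ∀ x : Fin n → ZMod 2, x ∈ C ↔ ∀ c ∈ C, ∑ j, x j * c j = 0 := by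
    intro x
    have h : x ∈ (C : Set (Fin n → ZMod 2)) ↔ x ∈ dualSet (C : Set (Fin n → ZMod 2)) := by
      rw [← hsd]
    exact h
  have hG : ∀ a, G a ∈ C := by
    intro a
    rw [← hspan]
    exact Submodule.subset_span ⟨a, rfl⟩
  have hsq : ∀ z : ZMod 2, z * z = z := by decide
  have hpair : ∀ a b, ∑ j, G a j * G b j = 0 := fun a b => (hmem _).1 (hG a) _ (hG b)
  constructor
  · rintro ⟨-, h3⟩
    have hrows : ∀ a b c, ∑ j, G a j * G b j * G c j = 0 := by
      intro a b c
      have e1 : ∀ a b c, ∑ j, G a j * G b j * G c j = ∑ j, G b j * G a j * G c j :=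
        fun a b c => Finset.sum_congr rfl fun j _ => by ring
      have e2 : ∀ a b c, ∑ j, G a j * G b j * G c j = ∑ j, G a j * G c j * G b j :=
        fun a b c => Finset.sum_congr rfl fun j _ => by ring
      have d : ∀ a c, ∑ j, G a j * G a j * G c j = 0 := by
        intro a c
        simp only [hsq]
        exact hpair a c
      rcases lt_trichotomy a b with h | h | h
      · rcases lt_trichotomy b c with h' | h' | h'
        · exact h3 a b c h h'
        · subst h'
          rw [e1, e2]; exact d _ _
        · rcases lt_trichotomy a c with g | g | g
          · rw [e2]; exact h3 _ _ _ g h'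
          · subst g
            rw [e2]; exact d _ _
          · rw [e2, e1]; exact h3 _ _ _ g h
      · subst h
        exact d _ _
      · rcases lt_trichotomy a c with h' | h' | h'
        · rw [e1]; exact h3 _ _ _ h h'
        · subst h'
          rw [e2]; exact d _ _
        · rcases lt_trichotomy b c with g | g | g
          · rw [e1, e2]; exact h3 _ _ _ g h'
          · subst g
            rw [e1, e2]; exact d _ _
          · rw [e1, e2, e1]; exact h3 _ _ _ g h
    have key : ∀ (u : Fin n → ZMod 2), (∀ a, ∑ j, u j * G a j = 0) →
        ∀ z ∈ C, ∑ j, u j * z j = 0 := by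
      intro u hu z hz
      rw [← hspan] at hz
      induction hz using Submodule.span_induction with
      | mem x hx => obtain ⟨a, rfl⟩ := hx; exact hu a
      | zero => simp
      | add x y _ _ hx hy => simp [mul_add, Finset.sum_add_distrib, hx, hy]
      | smul r x _ hx =>
        simp only [Pi.smul_apply, smul_eq_mul, mul_left_comm _ r, ← Finset.mul_sum, hx, mul_zero]
    intro x hx y hy
    rw [hmem]
    refine key _ fun a => ?_
    have h1 : ∑ j, (x * G a) j * y j = 0 := by
      refine key _ (fun b => ?_) y hy
      have h2 : ∑ j, (G a * G b) j * x j = 0 := key _ (fun c => hrows a b c) x hx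
      rw [← h2]
      exact Finset.sum_congr rfl fun j _ => by simp only [Pi.mul_apply]; ring
    rw [← h1]
    exact Finset.sum_congr rfl fun j _ => by simp only [Pi.mul_apply]; ring
  · intro h
    exact ⟨fun a b _ => hpair a b, fun a b c _ _ =>
      (hmem _).1 (h _ (hG a) _ (hG b)) _ (hG c)⟩
end

section
/- Let k ≥ 1 and let A be a k-by-k binary matrix, and let C ⊆ F₂^{2k} be the row span of the k-by-2k matrix [I_k | A]. Then C is a binary self-dual code which is also a triorthogonal space if and only if each row and each column of A contains exactly one 1 (i.e., A is a permutation matrix). -/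
/-- A linear subspace `H ⊆ F₂ⁿ` is a *triorthogonal space* if the coordinatewise product of any
three of its vectors has even Hamming weight. -/
def TriSpace {n : ℕ} (H : Submodule (ZMod 2) (Fin n → ZMod 2)) : Prop :=
  ∀ x ∈ H, ∀ y ∈ H, ∀ z ∈ H, Even (wt (x * y * z))

theorem z2_ne {x : ZMod 2} (h : x ≠ 0) : x = 1 := by
  revert h; revert x; decide

theorem even_wt_iff {n : ℕ} (x : Fin n → ZMod 2) : Even (wt x) ↔ ∑ j, x j = 0 := by
  have h : ∑ j, x j = ((wt x : ℕ) : ZMod 2) := by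
    unfold wt
    rw [Finset.card_filter]
    push_cast
    refine Finset.sum_congr rfl fun j _ => ?_
    by_cases hj : x j = 0
    · simp [hj]
    · simp [z2_ne hj]
  rw [h, ZMod.natCast_eq_zero_iff_even]

theorem tri_forward {k : ℕ} (A : Matrix (Fin k) (Fin k) (ZMod 2))
    (h3 : ∀ a b c, (∑ i, (1 : Matrix (Fin k) (Fin k) (ZMod 2)) a i *
      (1 : Matrix (Fin k) (Fin k) (ZMod 2)) b i * (1 : Matrix (Fin k) (Fin k) (ZMod 2)) c i)
      + ∑ j, A a j * A b j * A c j = 0) :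
    ((∀ a : Fin k, (Finset.univ.filter fun j => A a j ≠ 0).card = 1) ∧
       (∀ j : Fin k, (Finset.univ.filter fun a => A a j ≠ 0).card = 1)) := by
  have sq : ∀ x : ZMod 2, x * x = x := by decide
  have hA : A * A.transpose = 1 := by
    ext a b
    have h := h3 a a b
    simp only [sq] at h
    have e1 : ∑ i, (1 : Matrix (Fin k) (Fin k) (ZMod 2)) a i *
        (1 : Matrix (Fin k) (Fin k) (ZMod 2)) b i
        = (1 : Matrix (Fin k) (Fin k) (ZMod 2)) a b := by
      simp [Matrix.one_apply]
    rw [e1] at h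
    clear e1
    rw [Matrix.mul_apply]
    simp only [Matrix.transpose_apply]
    generalize (∑ j, A a j * A b j) = s at *
    generalize ((1 : Matrix (Fin k) (Fin k) (ZMod 2)) a b) = t at *
    clear h3
    revert s t; decide
  have hA' : A.transpose * A = 1 := mul_eq_one_comm.mp hA
  have disj : ∀ a b j, A a j ≠ 0 → A b j ≠ 0 → a = b := by
    intro a b j ha hb
    by_contra hab
    have hv : A.mulVec (fun j => A a j * A b j) = 0 := by
      ext c
      have h := h3 a b c
      have e1 : ∑ i, (1 : Matrix (Fin k) (Fin k) (ZMod 2)) a i *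
          (1 : Matrix (Fin k) (Fin k) (ZMod 2)) b i *
          (1 : Matrix (Fin k) (Fin k) (ZMod 2)) c i = 0 := by
        refine Finset.sum_eq_zero fun i _ => ?_
        by_cases h1 : a = i
        · have : b ≠ i := fun h => hab (h1.trans h.symm)
          simp [Matrix.one_apply, this]
        · simp [Matrix.one_apply, h1]
      rw [e1, zero_add] at h
      simp only [Matrix.mulVec, dotProduct, Pi.zero_apply]
      rw [← h]
      exact Finset.sum_congr rfl fun i _ => by ring
    have hv2 : A.transpose.mulVec (A.mulVec (fun j => A a j * A b j)) = 0 := by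
      rw [hv, Matrix.mulVec_zero]
    rw [Matrix.mulVec_mulVec, hA', Matrix.one_mulVec] at hv2
    have := congrFun hv2 j
    simp only [Pi.zero_apply] at this
    exact mul_ne_zero ha hb this
  have rowne : ∀ a, ∃ j, A a j ≠ 0 := by
    intro a
    by_contra! h
    have := congrFun (congrFun hA a) a
    simp [Matrix.mul_apply, h] at this
  choose f hf using rowne
  have finj : Function.Injective f := fun a b hab =>
    disj a b (f a) (hf a) (by rw [hab]; exact hf b)
  have fsurj := Finite.surjective_of_injective finj
  constructor
  · intro a
    rw [Finset.card_eq_one]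
    refine ⟨f a, ?_⟩
    ext j
    simp only [Finset.mem_filter, Finset.mem_univ, true_and, Finset.mem_singleton]
    constructor
    · intro h
      obtain ⟨b, rfl⟩ := fsurj j
      rw [disj a b _ h (hf b)]
    · rintro rfl; exact hf a
  · intro j
    rw [Finset.card_eq_one]
    obtain ⟨b, rfl⟩ := fsurj j
    refine ⟨b, ?_⟩
    ext a
    simp only [Finset.mem_filter, Finset.mem_univ, true_and, Finset.mem_singleton]
    constructor
    · intro h
      exact disj a b _ h (hf b)
    · rintro rfl; exact hf a

theorem perm_of {k : ℕ} (A : Matrix (Fin k) (Fin k) (ZMod 2))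
    (h1 : ∀ a : Fin k, (Finset.univ.filter fun j => A a j ≠ 0).card = 1)
    (h2 : ∀ j : Fin k, (Finset.univ.filter fun a => A a j ≠ 0).card = 1) :
    ∃ σ : Equiv.Perm (Fin k), ∀ a j, A a j = if j = σ a then 1 else 0 := by
  simp only [Finset.card_eq_one] at h1 h2
  choose f hf using h1
  choose g hg using h2
  have hf' : ∀ a j, A a j ≠ 0 ↔ j = f a := fun a j => by
    have := Finset.ext_iff.mp (hf a) j
    simpa using this
  have hg' : ∀ a j, A a j ≠ 0 ↔ a = g j := fun a j => by
    have := Finset.ext_iff.mp (hg j) a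
    simpa using this
  refine ⟨⟨f, g, fun a => ?_, fun j => ?_⟩, fun a j => ?_⟩
  · exact ((hg' a (f a)).mp ((hf' a (f a)).mpr rfl)).symm
  · exact ((hf' (g j) j).mp ((hg' (g j) j).mpr rfl)).symm
  · simp only [Equiv.coe_fn_mk]
    split_ifs with h
    · exact z2_ne ((hf' a j).mpr h)
    · by_contra h'
      exact h ((hf' a j).mp h')

theorem sum_zero_of {k : ℕ} (σ : Equiv.Perm (Fin k)) (x : Fin (k + k) → ZMod 2)
    (h : ∀ a, x (Fin.natAdd k (σ a)) = x (Fin.castAdd k a)) : ∑ j, x j = 0 := by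
  rw [Fin.sum_univ_add, ← Equiv.sum_comp σ (fun i => x (Fin.natAdd k i))]
  simp only [h]
  exact CharTwo.add_self_eq_zero _

/-- for `k ≥ 1` and a `k × k` binary matrix `A`, the row span `C ⊆ F₂^{2k}` of
`[I_k | A]` is a self-dual code which is also a triorthogonal space iff each row and each
column of `A` contains exactly one `1`, i.e. `A` is a permutation matrix. -/
theorem stmt_13 {k : ℕ} (hk : 1 ≤ k) (A : Matrix (Fin k) (Fin k) (ZMod 2))
    (C : Submodule (ZMod 2) (Fin (k + k) → ZMod 2))
    (hC : C = Submodule.span (ZMod 2) (Set.range fun a : Fin k =>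
      Fin.append ((1 : Matrix (Fin k) (Fin k) (ZMod 2)) a) (A a))) :
    ((C : Set (Fin (k + k) → ZMod 2)) = dualSet (C : Set (Fin (k + k) → ZMod 2)) ∧
        TriSpace C) ↔
      ((∀ a : Fin k, (Finset.univ.filter fun j => A a j ≠ 0).card = 1) ∧
       (∀ j : Fin k, (Finset.univ.filter fun a => A a j ≠ 0).card = 1)) := by
  constructor
  · rintro ⟨-, hT⟩
    apply tri_forward
    intro a b c
    have hm : ∀ a : Fin k,
        Fin.append ((1 : Matrix (Fin k) (Fin k) (ZMod 2)) a) (A a) ∈ C := fun a => by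
      rw [hC]; exact Submodule.subset_span ⟨a, rfl⟩
    have h := (even_wt_iff _).mp (hT _ (hm a) _ (hm b) _ (hm c))
    rw [Fin.sum_univ_add] at h
    simpa only [Pi.mul_apply, Fin.append_left, Fin.append_right] using h
  · rintro ⟨h1, h2⟩
    obtain ⟨σ, hσ⟩ := perm_of A h1 h2
    have hmem : ∀ x, x ∈ C ↔ ∀ a, x (Fin.natAdd k (σ a)) = x (Fin.castAdd k a) := by
      intro x
      constructor
      · intro hx
        rw [hC] at hx
        induction hx using Submodule.span_induction with
        | mem x hx =>
          obtain ⟨b, rfl⟩ := hx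
          intro a
          simp [-Fin.natAdd_eq_addNat, hσ, Matrix.one_apply, eq_comm]
        | zero => simp
        | add x y _ _ ihx ihy => intro a; simp [-Fin.natAdd_eq_addNat, ihx a, ihy a]
        | smul c x _ ih => intro a; simp [-Fin.natAdd_eq_addNat, ih a]
      · intro hx
        have e : x = ∑ a, x (Fin.castAdd k a) •
            Fin.append ((1 : Matrix (Fin k) (Fin k) (ZMod 2)) a) (A a) := by
          ext j
          rw [Finset.sum_apply]
          refine Fin.addCases (fun i => ?_) (fun i => ?_) j
          · simp [Matrix.one_apply]
          · obtain ⟨b, rfl⟩ := σ.surjective i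
            simp [-Fin.natAdd_eq_addNat, hσ, hx]
        rw [e, hC]
        exact Submodule.sum_mem _ fun a _ =>
          Submodule.smul_mem _ _ (Submodule.subset_span ⟨a, rfl⟩)
    refine ⟨?_, ?_⟩
    · ext x
      simp only [SetLike.mem_coe, dualSet, Set.mem_ofPred_eq]
      constructor
      · intro hx c hc
        rw [hmem] at hx hc
        exact sum_zero_of σ (fun j => x j * c j) fun a => by simp only [hx a, hc a]
      · intro hx
        rw [hmem]
        intro a
        have h := hx (Fin.append ((1 : Matrix (Fin k) (Fin k) (ZMod 2)) a) (A a))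
          (by rw [hC]; exact Submodule.subset_span ⟨a, rfl⟩)
        rw [Fin.sum_univ_add] at h
        simp only [Fin.append_left, Fin.append_right, hσ, Matrix.one_apply, mul_ite, mul_one,
          mul_zero, Finset.sum_ite_eq, Finset.sum_ite_eq', Finset.mem_univ, if_true] at h
        exact (CharTwo.add_eq_zero.mp h).symm
    · intro x hx y hy z hz
      rw [hmem] at hx hy hz
      rw [even_wt_iff]
      exact sum_zero_of σ _ fun a => by simp only [Pi.mul_apply, hx a, hy a, hz a]
end

section
/- Let A₀ ⊊ A ⊆ F₂^b be binary linear codes and let B ⊆ F₂^{2n} be a binary self-dual code. Then wt((A₀ ⊕ B)^⊥ \ (A ⊕ B)^⊥) = wt(A₀^⊥ \ A^⊥). (This identity shows that appending a self-dual triorthogonal block to a triorthogonal matrix preserves the distance d_Z of the associated triorthogonal code, giving parameters [[2n+b, k, d_Z]] from [[b, k, d_Z]].) -/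
theorem aux_sInf {S T : Set ℕ} (h : ∀ x ∈ S, ∃ y ∈ T, y ≤ x) (h' : ∀ x ∈ T, ∃ y ∈ S, y ≤ x) :
    sInf S = sInf T := by
  have key : ∀ {S T : Set ℕ}, (∀ x ∈ S, ∃ y ∈ T, y ≤ x) → (∀ x ∈ T, ∃ y ∈ S, y ≤ x) →
      sInf T ≤ sInf S := by
    intro S T h h'
    rcases S.eq_empty_or_nonempty with hS | hS
    · have : T = ∅ := by
        rw [Set.eq_empty_iff_forall_notMem]
        intro x hx
        obtain ⟨y, hy, _⟩ := h' x hx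
        simp [hS] at hy
      simp [hS, this]
    · obtain ⟨y, hy, hle⟩ := h _ (Nat.sInf_mem hS)
      exact (Nat.sInf_le hy).trans hle
  exact le_antisymm (key h' h) (key h h')

theorem aux_dot {m k : ℕ} (u a : Fin m → ZMod 2) (v c : Fin k → ZMod 2) :
    ∑ j, Fin.append u v j * Fin.append a c j = ∑ j, u j * a j + ∑ j, v j * c j := by
  simp [Fin.sum_univ_add]

theorem aux_wt {m k : ℕ} (u : Fin m → ZMod 2) (v : Fin k → ZMod 2) :
    wt (Fin.append u v) = wt u + wt v := by
  simp only [wt, Finset.card_filter]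
  simp [Fin.sum_univ_add]

theorem aux_ne {m : ℕ} {S : Set (Fin m → ZMod 2)} {x : Fin m → ZMod 2} (h : x ∉ dualSet S) :
    x ≠ 0 := by
  rintro rfl
  exact h (by intro c _; simp)

theorem aux_mem {m k : ℕ} (A : Submodule (ZMod 2) (Fin m → ZMod 2))
    (B : Submodule (ZMod 2) (Fin k → ZMod 2)) (u : Fin m → ZMod 2) (v : Fin k → ZMod 2) :
    Fin.append u v ∈ dualSet (dsum (A : Set (Fin m → ZMod 2)) (B : Set (Fin k → ZMod 2))) ↔
      u ∈ dualSet (A : Set (Fin m → ZMod 2)) ∧ v ∈ dualSet (B : Set (Fin k → ZMod 2)) := by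
  constructor
  · intro h
    refine ⟨fun a ha => ?_, fun c hc => ?_⟩
    · have := h _ ⟨a, ha, 0, B.zero_mem, rfl⟩
      rw [aux_dot] at this
      simpa using this
    · have := h _ ⟨0, A.zero_mem, c, hc, rfl⟩
      rw [aux_dot] at this
      simpa using this
  · rintro ⟨hu, hv⟩ _ ⟨a, ha, c, hc, rfl⟩
    rw [aux_dot, hu a ha, hv c hc, add_zero]

/-- for binary linear codes `A₀ ⊊ A ⊆ F₂^b` and a self-dual code `B ⊆ F₂^{2n}`,
`wt((A₀ ⊕ B)^⊥ \ (A ⊕ B)^⊥) = wt(A₀^⊥ \ A^⊥)`. -/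
theorem stmt_16 {b n : ℕ} (A₀ A : Submodule (ZMod 2) (Fin b → ZMod 2))
    (B : Submodule (ZMod 2) (Fin (n + n) → ZMod 2)) (hA : A₀ < A)
    (hB : (B : Set (Fin (n + n) → ZMod 2)) = dualSet (B : Set (Fin (n + n) → ZMod 2))) :
    wtSet (dualSet (dsum (A₀ : Set (Fin b → ZMod 2)) (B : Set (Fin (n + n) → ZMod 2))) \
        dualSet (dsum (A : Set (Fin b → ZMod 2)) (B : Set (Fin (n + n) → ZMod 2)))) =
      wtSet (dualSet (A₀ : Set (Fin b → ZMod 2)) \ dualSet (A : Set (Fin b → ZMod 2))) := by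
  unfold wtSet
  apply aux_sInf
  · rintro _ ⟨x, ⟨⟨h0, h1⟩, -⟩, rfl⟩
    obtain ⟨u, v, rfl⟩ : ∃ u v, x = Fin.append (m := b) (n := n + n) u v :=
      ⟨_, _, (Fin.append_castAdd_natAdd (f := x)).symm⟩
    rw [aux_mem] at h0 h1
    have hu : u ∉ dualSet (A : Set (Fin b → ZMod 2)) := fun h => h1 ⟨h, h0.2⟩
    refine ⟨_, ⟨u, ⟨⟨h0.1, hu⟩, aux_ne hu⟩, rfl⟩, ?_⟩
    rw [aux_wt]
    exact Nat.le_add_right _ _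
  · rintro _ ⟨u, ⟨⟨h0, h1⟩, -⟩, rfl⟩
    have hz : (0 : Fin (n + n) → ZMod 2) ∈ dualSet (B : Set (Fin (n + n) → ZMod 2)) := by
      intro c _
      simp
    have hx : Fin.append u 0 ∉ dualSet (dsum (A : Set (Fin b → ZMod 2))
        (B : Set (Fin (n + n) → ZMod 2))) := fun h => h1 ((aux_mem _ _ _ _).1 h).1
    refine ⟨_, ⟨Fin.append u 0, ⟨⟨(aux_mem _ _ _ _).2 ⟨h0, hz⟩, hx⟩, aux_ne hx⟩, rfl⟩, ?_⟩
    rw [aux_wt]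
    simp [wt]
end

section
/- Let C ⊆ F₂^{2k} be a binary self-dual code (so dim C = k), and let H ⊆ C be a finite set of codewords such that k > binom(|H|+1, 2), where |H| is the cardinality of H. Then there exists x ∈ C with x ∉ span(H) such that |x ∧ α ∧ β| ≡ 0 (mod 2) for all distinct α, β ∈ H. -/
lemma even_wt_of_sum {n : ℕ} (y : Fin n → ZMod 2) (h : ∑ j, y j = 0) : Even (wt y) := by
  have e : ∀ a : ZMod 2, a = if a ≠ 0 then 1 else 0 := by decide
  have : ∑ j, y j = ((wt y : ℕ) : ZMod 2) := by
    rw [Finset.sum_congr rfl (fun j _ => e (y j)), Finset.sum_boole]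
    rfl
  rw [this] at h
  exact (ZMod.natCast_eq_zero_iff_even).1 h

lemma le_finrank_selfDual {k : ℕ} (C : Submodule (ZMod 2) (Fin (k + k) → ZMod 2))
    (hsd : (C : Set (Fin (k + k) → ZMod 2)) = dualSet (C : Set (Fin (k + k) → ZMod 2))) :
    k ≤ Module.finrank (ZMod 2) C := by
  let f : (Fin (k + k) → ZMod 2) →ₗ[ZMod 2] Module.Dual (ZMod 2) C :=
    LinearMap.mk₂ (ZMod 2) (fun x (c : C) => ∑ j, x j * (c : Fin (k + k) → ZMod 2) j)
      (by intros; simp [add_mul, Finset.sum_add_distrib])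
      (by intros; simp [Finset.mul_sum, mul_assoc])
      (by intros; simp [mul_add, Finset.sum_add_distrib])
      (by intros; simp [Finset.mul_sum, mul_left_comm])
  have hker : LinearMap.ker f ≤ C := by
    intro x hx
    have : x ∈ (C : Set (Fin (k + k) → ZMod 2)) := by
      rw [hsd]
      intro c hc
      exact LinearMap.congr_fun (LinearMap.mem_ker.1 hx) ⟨c, hc⟩
    exact this
  have h1 := f.finrank_range_add_finrank_ker
  have h2 := Submodule.finrank_mono hker
  have h3 := (LinearMap.range f).finrank_le
  rw [Subspace.dual_finrank_eq] at h3
  rw [Module.finrank_fin_fun] at h1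
  omega

/-- let `C ⊆ F₂^{2k}` be a binary self-dual code and `H ⊆ C` a finite set of
codewords with `k > binom(|H| + 1, 2)`.  Then there is `x ∈ C` outside the span of `H` such
that `|x ∧ α ∧ β|` is even for all distinct `α, β ∈ H`. -/
theorem stmt_18 {k : ℕ} (C : Submodule (ZMod 2) (Fin (k + k) → ZMod 2))
    (hsd : (C : Set (Fin (k + k) → ZMod 2)) = dualSet (C : Set (Fin (k + k) → ZMod 2)))
    (H : Finset (Fin (k + k) → ZMod 2)) (hHC : ∀ x ∈ H, x ∈ C)
    (hk : (H.card + 1).choose 2 < k) :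
    ∃ x ∈ C, x ∉ Submodule.span (ZMod 2) (H : Set (Fin (k + k) → ZMod 2)) ∧
      ∀ α ∈ H, ∀ β ∈ H, α ≠ β → Even (wt (x * α * β)) := by
  classical
  have hC := le_finrank_selfDual C hsd
  let g : C →ₗ[ZMod 2] ((H.powersetCard 2 : Finset _) → ZMod 2) :=
    LinearMap.pi fun s => 
      { toFun := fun x => ∑ j, (x : Fin (k + k) → ZMod 2) j * (∏ a ∈ s.1, a) j
        map_add' := by intros; simp [add_mul, Finset.sum_add_distrib]
        map_smul' := by intros; simp [Finset.mul_sum, mul_assoc] }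
  have h1 := g.finrank_range_add_finrank_ker
  have h2 := (LinearMap.range g).finrank_le
  rw [Module.finrank_fintype_fun_eq_card, Fintype.card_coe, Finset.card_powersetCard] at h2
  have h3 : (H.card + 1).choose 2 = H.card + H.card.choose 2 := by
    rw [Nat.choose_succ_succ' H.card 1, Nat.choose_one_right]
  have h4 := finrank_span_finset_le_card (R := ZMod 2) H
  have h5 : ¬ (LinearMap.ker g).map C.subtype ≤
      Submodule.span (ZMod 2) (H : Set (Fin (k + k) → ZMod 2)) := by
    intro hle
    have h6 := Submodule.finrank_mono hle
    rw [Submodule.finrank_map_subtype_eq] at h6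
    rw [Set.finrank] at h4
    omega
  obtain ⟨_, ⟨x, hx, rfl⟩, hn⟩ := SetLike.not_le_iff_exists.1 h5
  refine ⟨x, x.2, hn, fun α hα β hβ hne => even_wt_of_sum _ ?_⟩
  have hs : ({α, β} : Finset _) ∈ H.powersetCard 2 := by
    rw [Finset.mem_powersetCard]
    refine ⟨?_, Finset.card_pair hne⟩
    intro y hy
    simp only [Finset.mem_insert, Finset.mem_singleton] at hy
    rcases hy with rfl | rfl <;> assumption
  have h7 : ∑ j, (x : Fin (k + k) → ZMod 2) j * (∏ a ∈ ({α, β} : Finset _), a) j = 0 :=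
    congrFun (LinearMap.mem_ker.1 hx) ⟨{α, β}, hs⟩
  rw [Finset.prod_pair hne] at h7
  simpa [mul_assoc] using h7
end

section
/- Let r ≥ 3 be an integer and let C ⊆ F₂^{2k} be a binary self-dual code (so dim C = k). If k > binom(r, 2), then there exists a triorthogonal space of dimension r that is a linear subspace of C. Moreover, if k > binom(r−1, 2) + 1, then there exists a triorthogonal space of dimension r that is a linear subspace of C and contains the all-one vector 𝟏 of length 2k. -/
open Module in
/-- Sum of coordinates of `x * y * z`, as a bilinear form in the last two arguments. -/
def trif {n : ℕ} (v : Fin n → ZMod 2) :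
    (Fin n → ZMod 2) →ₗ[ZMod 2] (Fin n → ZMod 2) →ₗ[ZMod 2] ZMod 2 :=
  LinearMap.mk₂ (ZMod 2) (fun x y => ∑ j, x j * y j * v j)
    (by intros; simp [← Finset.sum_add_distrib, add_mul])
    (by intros; simp [Finset.mul_sum, mul_assoc])
    (by intros; simp [← Finset.sum_add_distrib, add_mul, mul_add])
    (by intros; simp only [Pi.smul_apply, smul_eq_mul, Finset.mul_sum]
        exact Finset.sum_congr rfl fun _ _ => by ring)

theorem trif_apply {n : ℕ} (v x y : Fin n → ZMod 2) :
    trif v x y = ∑ j, x j * y j * v j := rfl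

theorem wt_even {n : ℕ} (x : Fin n → ZMod 2) (h : ∑ j, x j = 0) : Even (wt x) := by
  have h2 : ((wt x : ℕ) : ZMod 2) = ∑ j, x j := by
    unfold wt
    rw [Finset.card_filter]
    push_cast
    refine Finset.sum_congr rfl fun j _ => ?_
    generalize x j = a
    revert a
    decide
  rw [h] at h2
  exact (ZMod.natCast_eq_zero_iff_even).1 h2

open Module in
/-- Cutting `S` by the linear conditions indexed by `T` loses at most `dim T` dimensions. -/
theorem cut {n : ℕ} (v : Fin n → ZMod 2) (S T : Submodule (ZMod 2) (Fin n → ZMod 2)) :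
    ∃ S' : Submodule (ZMod 2) (Fin n → ZMod 2),
      (∀ z, z ∈ S' ↔ z ∈ S ∧ ∀ x ∈ T, trif v z x = 0) ∧
      finrank (ZMod 2) S ≤ finrank (ZMod 2) S' + finrank (ZMod 2) T := by
  let f : S →ₗ[ZMod 2] (T →ₗ[ZMod 2] ZMod 2) := (trif v).compl₁₂ S.subtype T.subtype
  refine ⟨(LinearMap.ker f).map S.subtype, ?_, ?_⟩
  · intro z
    constructor
    · rintro ⟨s, hs, rfl⟩
      refine ⟨s.2, fun x hx => ?_⟩
      have := LinearMap.congr_fun (LinearMap.mem_ker.1 hs) ⟨x, hx⟩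
      simpa [f] using this
    · rintro ⟨hz, h⟩
      refine ⟨⟨z, hz⟩, ?_, rfl⟩
      apply LinearMap.mem_ker.2
      ext x
      simpa [f] using h x x.2
  · rw [Submodule.finrank_map_subtype_eq]
    have h1 := LinearMap.finrank_range_add_finrank_ker f
    have h2 := Submodule.finrank_le (LinearMap.range f)
    have h3 : finrank (ZMod 2) (T →ₗ[ZMod 2] ZMod 2) = finrank (ZMod 2) T :=
      Subspace.dual_finrank_eq
    omega

theorem zsq (a : ZMod 2) : a * a = a := by revert a; decide

open Module in
theorem build {n k : ℕ} (C W : Submodule (ZMod 2) (Fin n → ZMod 2))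
    (hk : k ≤ finrank (ZMod 2) C) (hWC : W ≤ C)
    (hC : ∀ x ∈ C, ∀ y ∈ C, ∑ j, x j * y j = 0)
    (hW : ∀ w ∈ W, ∀ x ∈ C, ∀ y ∈ C, ∑ j, x j * y j * w j = 0) :
    ∀ m : ℕ, m.choose 2 + finrank (ZMod 2) W < k →
    ∃ T S : Submodule (ZMod 2) (Fin n → ZMod 2), Disjoint T W ∧ finrank (ZMod 2) T = m ∧
      S ≤ C ∧ T ⊔ W ≤ S ∧ k ≤ finrank (ZMod 2) S + m.choose 2 ∧
      ∀ x ∈ T, ∀ y ∈ T, ∀ z ∈ S, ∑ j, x j * y j * z j = 0 := by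
  intro m
  induction m with
  | zero =>
    intro _
    refine ⟨⊥, C, disjoint_bot_left, by simp, le_rfl, by simpa using hWC, by simpa using hk, ?_⟩
    intro x hx y _ z _
    rw [Submodule.mem_bot] at hx
    simp [hx]
  | succ m ih =>
    intro hm
    have hch : (m + 1).choose 2 = m + m.choose 2 := by
      rw [Nat.choose_succ_succ' m 1]; simp
    obtain ⟨T, S, hTW, hT, hSC, hTS, hkS, htri⟩ := ih (by omega)
    have hTWr : finrank (ZMod 2) (T ⊔ W : Submodule _ _) = m + finrank (ZMod 2) W := by
      have := Submodule.finrank_sup_add_finrank_inf_eq T W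
      rw [hTW.eq_bot] at this
      simp at this
      omega
    have hex : ∃ v ∈ S, v ∉ T ⊔ W := by
      by_contra! hcon
      have := Submodule.finrank_mono (R := ZMod 2) (s := S) (t := T ⊔ W) hcon
      omega
    obtain ⟨v, hvS, hv⟩ := hex
    obtain ⟨S', hS', hcut⟩ := cut v S T
    have hv0 : v ≠ 0 := by
      rintro rfl
      exact hv (zero_mem _)
    have hTS1 : T ≤ S := le_sup_left.trans hTS
    have hdis : Disjoint T (Submodule.span (ZMod 2) {v}) := by
      rw [Submodule.disjoint_span_singleton' hv0]
      exact fun h => hv (Submodule.mem_sup_left h)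
    refine ⟨T ⊔ Submodule.span (ZMod 2) {v}, S', ?_, ?_, ?_, ?_, ?_, ?_⟩
    · have h1 : Disjoint (T ⊔ W) (Submodule.span (ZMod 2) {v}) := by
        rw [Submodule.disjoint_span_singleton' hv0]
        exact hv
      rw [sup_comm T]
      exact (hTW.symm.disjoint_sup_right_of_disjoint_sup_left
        (by rw [sup_comm]; exact h1) |>.symm |> fun h => by rw [sup_comm]; exact h)
    · have := Submodule.finrank_sup_add_finrank_inf_eq T (Submodule.span (ZMod 2) {v})
      rw [hdis.eq_bot, finrank_span_singleton hv0] at this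
      simp at this
      omega
    · exact fun z hz => hSC ((hS' z).1 hz).1
    · refine sup_le (sup_le ?_ ?_) ?_
      · intro z hz
        exact (hS' z).2 ⟨hTS1 hz, fun x hx => htri z hz x hx v hvS⟩
      · rw [Submodule.span_singleton_le_iff_mem]
        refine (hS' v).2 ⟨hvS, fun x hx => ?_⟩
        rw [trif_apply, ← hC v (hSC hvS) x (hSC (hTS1 hx))]
        refine Finset.sum_congr rfl fun j _ => ?_
        linear_combination x j * zsq (v j)
      · intro w hw
        refine (hS' w).2 ⟨hTS (Submodule.mem_sup_right hw), fun x hx => ?_⟩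
        rw [trif_apply, ← hW w hw x (hSC (hTS1 hx)) v (hSC hvS)]
        exact Finset.sum_congr rfl fun j _ => by ring
    · omega
    · intro x hx y hy z hz
      obtain ⟨hzS, hzT⟩ := (hS' z).1 hz
      obtain ⟨a, ha, a', ha', rfl⟩ := Submodule.mem_sup.1 hx
      obtain ⟨b, hb, b', hb', rfl⟩ := Submodule.mem_sup.1 hy
      obtain ⟨s, rfl⟩ := Submodule.mem_span_singleton.1 ha'
      obtain ⟨t, rfl⟩ := Submodule.mem_span_singleton.1 hb'
      have e1 := htri a ha b hb z hzS
      have e2 := hzT a ha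
      have e3 := hzT b hb
      have e4 := hC v (hSC hvS) z (hSC hzS)
      rw [trif_apply] at e2 e3
      have : ∑ j, (a + s • v) j * (b + t • v) j * z j =
          ∑ j, a j * b j * z j + t * ∑ j, z j * a j * v j + s * ∑ j, z j * b j * v j
            + s * t * ∑ j, v j * z j := by
        simp only [Finset.mul_sum, ← Finset.sum_add_distrib, Pi.add_apply, Pi.smul_apply,
          smul_eq_mul]
        refine Finset.sum_congr rfl fun j _ => ?_
        linear_combination s * t * z j * zsq (v j)
      rw [this, e1, e2, e3, e4]
      simp

open Module in
theorem build2 {n k : ℕ} (C W : Submodule (ZMod 2) (Fin n → ZMod 2))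
    (hk : k ≤ finrank (ZMod 2) C) (hWC : W ≤ C)
    (hC : ∀ x ∈ C, ∀ y ∈ C, ∑ j, x j * y j = 0)
    (hW : ∀ w ∈ W, ∀ x ∈ C, ∀ y ∈ C, ∑ j, x j * y j * w j = 0)
    (m : ℕ) (hm : m.choose 2 + finrank (ZMod 2) W < k) :
    ∃ T : Submodule (ZMod 2) (Fin n → ZMod 2), T ≤ C ∧
      finrank (ZMod 2) T = m + finrank (ZMod 2) W ∧ TriSpace T ∧ W ≤ T := by
  obtain ⟨T, S, hTW, hT, hSC, hTS, -, htri⟩ := build C W hk hWC hC hW m hm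
  refine ⟨T ⊔ W, hTS.trans hSC, ?_, ?_, le_sup_right⟩
  · have := Submodule.finrank_sup_add_finrank_inf_eq T W
    rw [hTW.eq_bot] at this
    simp at this
    omega
  · intro x hx y hy z hz
    apply wt_even
    obtain ⟨a, ha, a', ha', rfl⟩ := Submodule.mem_sup.1 hx
    have hyC := hSC (hTS hy)
    obtain ⟨b, hb, b', hb', rfl⟩ := Submodule.mem_sup.1 hy
    have hzS := hTS hz
    have e1 := htri a ha b hb z hzS
    have e2 := hW a' ha' _ hyC z (hSC hzS)
    have e3 := hW b' hb' a (hSC (hTS (Submodule.mem_sup_left ha))) z (hSC hzS)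
    have : ∑ j, ((a + a') * (b + b') * z) j = ∑ j, a j * b j * z j
        + ∑ j, (b + b') j * z j * a' j + ∑ j, a j * z j * b' j := by
      simp only [← Finset.sum_add_distrib, Pi.add_apply, Pi.mul_apply]
      exact Finset.sum_congr rfl fun j _ => by ring
    rw [this, e1, e2, e3]
    simp

/-- let `r ≥ 3` and let `C ⊆ F₂^{2k}` be a binary self-dual code.  If
`k > binom(r, 2)` then `C` contains a triorthogonal subspace of dimension `r`; if moreover
`k > binom(r-1, 2) + 1` then `C` contains a triorthogonal subspace of dimension `r` containing
the all-one vector. -/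
theorem stmt_19 {k r : ℕ} (hr : 3 ≤ r)
    (C : Submodule (ZMod 2) (Fin (k + k) → ZMod 2))
    (hsd : (C : Set (Fin (k + k) → ZMod 2)) = dualSet (C : Set (Fin (k + k) → ZMod 2))) :
    (r.choose 2 < k → ∃ T : Submodule (ZMod 2) (Fin (k + k) → ZMod 2),
      T ≤ C ∧ Module.finrank (ZMod 2) ↥T = r ∧ TriSpace T) ∧
    ((r - 1).choose 2 + 1 < k → ∃ T : Submodule (ZMod 2) (Fin (k + k) → ZMod 2),
      T ≤ C ∧ Module.finrank (ZMod 2) ↥T = r ∧ TriSpace T ∧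
        (1 : Fin (k + k) → ZMod 2) ∈ T) := by
  have hmem : ∀ x, x ∈ C ↔ ∀ c ∈ C, ∑ j, x j * c j = 0 := by
    intro x
    have : x ∈ (C : Set (Fin (k + k) → ZMod 2)) ↔
        x ∈ dualSet (C : Set (Fin (k + k) → ZMod 2)) := by rw [← hsd]
    simpa [dualSet] using this
  have hC : ∀ x ∈ C, ∀ y ∈ C, ∑ j, x j * y j = 0 := fun x hx => (hmem x).1 hx
  have hk : k ≤ Module.finrank (ZMod 2) C := by
    obtain ⟨S', hS', hcut⟩ := cut 1 ⊤ C
    have : S' = C := by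
      ext z
      rw [hS', hmem]
      simp [trif_apply]
    subst this
    simp at hcut
    omega
  have h1C : (1 : Fin (k + k) → ZMod 2) ∈ C := by
    rw [hmem]
    intro c hc
    rw [← hC c hc c hc]
    exact Finset.sum_congr rfl fun j _ => by rw [zsq]; simp
  constructor
  · intro h
    obtain ⟨T, h1, h2, h3, -⟩ := build2 C ⊥ hk bot_le hC
      (by intro w hw x _ y _; rw [Submodule.mem_bot] at hw; simp [hw]) r (by simpa using h)
    exact ⟨T, h1, by simpa using h2, h3⟩
  · intro h
    have hne : (1 : Fin (k + k) → ZMod 2) ≠ 0 := by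
      intro h0
      have := congrFun h0 ⟨0, by omega⟩
      simp at this
    have hf := finrank_span_singleton (K := ZMod 2) hne
    obtain ⟨T, h1, h2, h3, h4⟩ := build2 C (Submodule.span (ZMod 2) {1}) hk
      ((Submodule.span_singleton_le_iff_mem _ _).2 h1C) hC
      (by
        intro w hw x hx y hy
        obtain ⟨s, rfl⟩ := Submodule.mem_span_singleton.1 hw
        simp [← Finset.sum_mul, hC x hx y hy]) (r - 1) (by rw [hf]; exact h)
    exact ⟨T, h1, by omega, h3, (Submodule.span_singleton_le_iff_mem _ _).1 h4⟩
end
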